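/- arXiv:math/0312420 — 12 statements merged into one kernel-verified Lean document; each statement's English description precedes it below -/
import Mathlib

section
/- Let W, G, H be groups and let μ₀ : W →* G be a surjective group homomorphism with N = MonoidHom.ker μ₀. Then the G-closure computed with respect to H satisfies: the intersection of the kernels of all homomorphisms μ : W →* H with N ≤ MonoidHom.ker μ equals Subgroup.comap μ₀ of the normal subgroup (H-Ker)(G). In particular, for any normal subgroup N of a group W, the H-closure of N equals the preimage under the quotient map W →* W ⧸ N of (H-Ker)(W ⧸ N). -/
/-- The intersection of the kernels of all homomorphisms `μ : W →* H` that kill the kernel of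
a surjection `f : W →* G` is the preimage under `f` of the intersection of the kernels of all
homomorphisms `G →* H`. -/
theorem MonoidHom.iInf_ker_eq_comap_of_surjective {W G H : Type*} [Group W] [Group G] [Group H]
    (f : W →* G) (hf : Function.Surjective f) {N : Subgroup W} (hN : f.ker = N) :
    (⨅ μ : {μ : W →* H // N ≤ μ.ker}, μ.1.ker) =
      Subgroup.comap f (⨅ ν : G →* H, ν.ker) := by
  subst hN
  rw [Subgroup.comap_iInf]
  refine (f.liftOfSurjective hf).iInf_congr fun μ => ?_
  rw [MonoidHom.comap_ker]
  exact congrArg MonoidHom.ker (f.liftOfRightInverse_comp _ (Function.rightInverse_surjInv hf) μ)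

/-- §3.2, Theorems 2.2 and 2.3 (general Hilbert Nullstellensatz) for groups: given a
surjection `μ₀ : W →* G` with kernel `N`, the `H`-closure of `N` (the intersection of the
kernels of all `μ : W →* H` with `N ≤ ker μ`) equals the preimage under `μ₀` of
`(H-Ker)(G) = ⨅ ν : G →* H, ker ν`.  In particular, for any normal subgroup `N` of `W`,
the `H`-closure of `N` is the preimage under the quotient map of `(H-Ker)(W ⧸ N)`. -/
theorem closure_eq_comap_interKer {W G H : Type*} [Group W] [Group G] [Group H]
    (μ₀ : W →* G) (hμ₀ : Function.Surjective μ₀) :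
    ((⨅ μ : {μ : W →* H // MonoidHom.ker μ₀ ≤ MonoidHom.ker μ}, MonoidHom.ker μ.1) =
      Subgroup.comap μ₀ (⨅ ν : G →* H, MonoidHom.ker ν)) ∧
    ∀ (N : Subgroup W) [N.Normal],
      (⨅ μ : {μ : W →* H // N ≤ MonoidHom.ker μ}, MonoidHom.ker μ.1) =
        Subgroup.comap (QuotientGroup.mk' N) (⨅ ν : W ⧸ N →* H, MonoidHom.ker ν) := by
  exact ⟨μ₀.iInf_ker_eq_comap_of_surjective hμ₀ rfl, fun N _ =>
    (QuotientGroup.mk' N).iInf_ker_eq_comap_of_surjective (QuotientGroup.mk'_surjective N)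
      (QuotientGroup.ker_mk' N)⟩
end

section
/- Let P be a field, let A be a commutative ring with a P-algebra structure such that A is a finitely generated P-algebra (Algebra.FiniteType P A), and let K be an algebraically closed field with a P-algebra structure (an algebraically closed extension of P). Then the intersection of the ideals RingHom.ker ν over all P-algebra homomorphisms ν : A →ₐ[P] K equals the nilradical of A (equivalently, the Jacobson radical of A), the intersection over an empty family being the unit ideal. -/
/-- Every maximal ideal of a finitely generated algebra over a field `P` is the kernel of a
`P`-algebra homomorphism to any given algebraically closed extension of `P`. -/
theorem Ideal.IsMaximal.exists_algHom_ker_eq {P A : Type*} (K : Type*) [Field P]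
    [CommRing A] [Algebra P A] [Algebra.FiniteType P A]
    [Field K] [IsAlgClosed K] [Algebra P K] {m : Ideal A} (hm : m.IsMaximal) :
    ∃ ν : A →ₐ[P] K, RingHom.ker ν = m := by
  let : Field (A ⧸ m) := Ideal.Quotient.field m
  have : Algebra.FiniteType P (A ⧸ m) :=
    Algebra.FiniteType.of_surjective (Ideal.Quotient.mkₐ P m) (Ideal.Quotient.mkₐ_surjective P m)
  have : Module.Finite P (A ⧸ m) := finite_of_finite_type_of_isJacobsonRing P (A ⧸ m)
  let φ : A ⧸ m →ₐ[P] K := IsAlgClosed.lift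
  refine ⟨φ.comp (Ideal.Quotient.mkₐ P m), ?_⟩
  ext a
  rw [RingHom.mem_ker, AlgHom.comp_apply, map_eq_zero_iff φ φ.toRingHom.injective]
  exact Ideal.Quotient.eq_zero_iff_mem

/-- §3.2: the key identity `(K-Ker)(A) = Rad A` used to derive the classical Hilbert
Nullstellensatz from the general one.  For a finitely generated commutative algebra `A` over
a field `P` and an algebraically closed extension `K` of `P`, the intersection of the kernels
of all `P`-algebra homomorphisms `A → K` equals the nilradical of `A`, which coincides with
the Jacobson radical of `A`. -/
theorem interKer_algHom_eq_nilradical {P A K : Type*} [Field P]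
    [CommRing A] [Algebra P A] [Algebra.FiniteType P A]
    [Field K] [IsAlgClosed K] [Algebra P K] :
    ((⨅ ν : A →ₐ[P] K, RingHom.ker ν) = nilradical A) ∧
    ((⨅ ν : A →ₐ[P] K, RingHom.ker ν) = Ideal.jacobson (⊥ : Ideal A)) := by
  have : IsJacobsonRing A := isJacobsonRing_of_finiteType (A := P)
  have h_rad : nilradical A = Ideal.jacobson ⊥ := Ideal.radical_eq_jacobson ⊥
  have h_le : nilradical A ≤ ⨅ ν : A →ₐ[P] K, RingHom.ker ν :=
    le_iInf fun ν =>
      have := RingHom.ker_isPrime ν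
      nilradical_le_prime (RingHom.ker ν)
  have h_ge : (⨅ ν : A →ₐ[P] K, RingHom.ker ν) ≤ Ideal.jacobson ⊥ := by
    refine le_sInf fun m hm => ?_
    obtain ⟨ν, rfl⟩ := hm.2.exists_algHom_ker_eq (P := P) K
    exact iInf_le _ ν
  exact ⟨le_antisymm (h_rad ▸ h_ge) h_le, le_antisymm h_ge (h_rad ▸ h_le)⟩
end

section
/- Let P be a field, K an algebraically closed field with a P-algebra structure (an algebraically closed extension of P), n : ℕ, R = MvPolynomial (Fin n) P, and I an ideal of R. Then the intersection of the ideals RingHom.ker φ over all P-algebra homomorphisms φ : R →ₐ[P] K with I ≤ RingHom.ker φ equals the radical I.radical of I (the intersection over an empty family being the unit ideal). -/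
/-- §3.1–3.2: the classical Hilbert Nullstellensatz.  For an ideal `I` of the polynomial ring
`R = P[x₁, …, xₙ]` over a field `P` and an algebraically closed extension `K` of `P`, the
closure `I″` of `I`, i.e. the intersection of the kernels of all points (`P`-algebra
homomorphisms `R → K`) whose kernel contains `I`, equals the radical of `I`. -/
theorem nullstellensatz_closure_eq_radical {P K : Type*} [Field P]
    [Field K] [IsAlgClosed K] [Algebra P K] (n : ℕ)
    (I : Ideal (MvPolynomial (Fin n) P)) :
    (⨅ φ : {φ : MvPolynomial (Fin n) P →ₐ[P] K // I ≤ RingHom.ker φ},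
        RingHom.ker φ.1) = I.radical := by
  rw [← MvPolynomial.vanishingIdeal_zeroLocus_eq_radical (K := K) I]
  ext p
  simp only [Ideal.mem_iInf, Subtype.forall, RingHom.mem_ker,
    MvPolynomial.mem_vanishingIdeal_iff, MvPolynomial.mem_zeroLocus_iff]
  constructor
  · intro h x hx
    exact h (MvPolynomial.aeval x) fun q hq => hx q hq
  · intro h φ hφ
    have key : ∀ q, MvPolynomial.aeval (fun i => φ (MvPolynomial.X i)) q = φ q := fun q => by
      rw [← MvPolynomial.comp_aeval_apply, MvPolynomial.aeval_X_left_apply]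
    rw [← key]
    exact h _ fun q hq => (key q).trans (hφ hq)
end

section
/- Let X be a type, F = FreeGroup X, and let F′ = ⁅(⊤ : Subgroup F), ⊤⁆ denote the commutator subgroup of F. Let G be a group of infinite exponent, i.e. Monoid.exponent G = 0. Then the G-closure of F′ equals F′: the intersection of the kernels of all group homomorphisms μ : F →* G with F′ ≤ MonoidHom.ker μ (equivalently, with abelian image) is exactly the commutator subgroup F′. -/
/-- The `G`-closure of a normal subgroup `N` of `W`: the intersection of the kernels of all
homomorphisms `μ : W →* G` with `N ≤ ker μ` (over an empty family this is all of `W`). -/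
def gClosure (G : Type*) [Group G] {W : Type*} [Group W] (N : Subgroup W) : Subgroup W :=
  ⨅ μ : {μ : W →* G // N ≤ MonoidHom.ker μ}, MonoidHom.ker μ.1

/-- Homomorphisms to `ℤ` separate a free group modulo its commutator subgroup. -/
theorem FreeGroup.exists_hom_int_ne_one_of_notMem_commutator {X : Type*} {w : FreeGroup X}
    (hw : w ∉ commutator (FreeGroup X)) :
    ∃ φ : FreeGroup X →* Multiplicative ℤ, φ w ≠ 1 := by
  set a : FreeAbelianGroup X := Additive.ofMul (Abelianization.of w)
  have ha : a ≠ 0 := fun h => hw ((QuotientGroup.eq_one_iff w).1 h)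
  have hs : FreeAbelianGroup.toFinsupp a ≠ 0 := fun h =>
    ha ((FreeAbelianGroup.equivFinsupp X).injective (h.trans (map_zero _).symm))
  obtain ⟨x, hx⟩ := Finsupp.ne_iff.1 hs
  refine ⟨(AddMonoidHom.toMultiplicativeRight (FreeAbelianGroup.coeff x)).comp
    Abelianization.of, fun h => hx ?_⟩
  exact h

/-- In a group of infinite exponent, no nonzero power map `g ↦ g ^ n` is trivial. -/
theorem Monoid.exists_zpow_ne_one_of_exponent_eq_zero {G : Type*} [Group G]
    (hG : Monoid.exponent G = 0) {n : ℤ} (hn : n ≠ 0) : ∃ g : G, g ^ n ≠ 1 := by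
  obtain ⟨g, hg⟩ := Monoid.exponent_eq_zero_iff_forall.1 hG n.natAbs (Int.natAbs_pos.2 hn)
  exact ⟨g, fun h => hg (pow_natAbs_eq_one.2 h)⟩

theorem le_gClosure (G : Type*) [Group G] {W : Type*} [Group W] (N : Subgroup W) :
    N ≤ gClosure G N :=
  le_iInf fun μ => μ.2

/-- §3.3 (example following Theorem 3.1 on verbal congruences): if `G` is a group of infinite
exponent, then the commutator subgroup `F′ = ⁅⊤, ⊤⁆` of the free group `F = FreeGroup X` is
`G`-closed: the intersection of the kernels of all homomorphisms `F →* G` with abelian image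
is exactly `F′`. -/
theorem gClosure_commutator_eq_of_exponent_zero {X G : Type*} [Group G]
    (hG : Monoid.exponent G = 0) :
    gClosure G ⁅(⊤ : Subgroup (FreeGroup X)), (⊤ : Subgroup (FreeGroup X))⁆ =
      ⁅(⊤ : Subgroup (FreeGroup X)), (⊤ : Subgroup (FreeGroup X))⁆ := by
  refine le_antisymm (fun w hw => ?_) (le_gClosure G _)
  by_contra hwc
  obtain ⟨φ, hφ⟩ := FreeGroup.exists_hom_int_ne_one_of_notMem_commutator hwc
  obtain ⟨g, hg⟩ := Monoid.exists_zpow_ne_one_of_exponent_eq_zero hG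
    (n := (φ w).toAdd) (fun h => hφ (Multiplicative.toAdd.injective h))
  have hker : commutator (FreeGroup X) ≤ ((zpowersHom G g).comp φ).ker :=
    (Abelianization.commutator_subset_ker φ).trans fun v hv => by
      simp [MonoidHom.mem_ker, MonoidHom.mem_ker.1 hv]
  exact hg (Subgroup.mem_iInf.1 hw ⟨(zpowersHom G g).comp φ, hker⟩)
end

section
/- Let G₁ and G₂ be finite simple groups. Then G₁ and G₂ are geometrically ℕ-equivalent (i.e. X-equivalent for a countably infinite type X) if and only if they are isomorphic, i.e. Nonempty (G₁ ≃* G₂). -/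
theorem gClosure_ker {G : Type*} [Group G] {W : Type*} [Group W] (μ : W →* G) :
    gClosure G μ.ker = μ.ker :=
  le_antisymm (iInf_le (fun ν : {ν : W →* G // μ.ker ≤ ν.ker} => ν.1.ker) ⟨μ, le_rfl⟩)
    (le_gClosure G _)

theorem gClosure_le_of_injective {G₁ G₂ : Type*} [Group G₁] [Group G₂] (f : G₁ →* G₂)
    (hf : Function.Injective f) {W : Type*} [Group W] (N : Subgroup W) :
    gClosure G₂ N ≤ gClosure G₁ N := by
  refine le_iInf fun μ => ?_
  have hker : (f.comp μ.1).ker = μ.1.ker := by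
    ext w
    simp [MonoidHom.mem_ker, map_eq_one_iff f hf]
  exact (iInf_le (fun ν : {ν : W →* G₂ // N ≤ ν.ker} => ν.1.ker)
    ⟨f.comp μ.1, hker.symm ▸ μ.2⟩).trans hker.le

theorem exists_freeGroup_nat_surjective (G : Type*) [Group G] [Countable G] :
    ∃ π : FreeGroup ℕ →* G, Function.Surjective π := by
  obtain ⟨f, hf⟩ := exists_surjective_nat G
  refine ⟨FreeGroup.lift f, fun g => ?_⟩
  obtain ⟨n, rfl⟩ := hf g
  exact ⟨FreeGroup.of n, FreeGroup.lift_apply_of⟩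

/-- A countable simple group embeds into every group whose closure operator is bounded by its
own. -/
theorem exists_injective_of_gClosure_le {G₁ G₂ : Type*} [Group G₁] [Group G₂] [Countable G₁]
    [IsSimpleGroup G₁]
    (h : ∀ N : Subgroup (FreeGroup ℕ), N.Normal → gClosure G₂ N ≤ gClosure G₁ N) :
    ∃ f : G₁ →* G₂, Function.Injective f := by
  obtain ⟨π, hπ⟩ := exists_freeGroup_nat_surjective G₁
  obtain ⟨g, hg⟩ := exists_ne (1 : G₁)
  obtain ⟨w, rfl⟩ := hπ g
  have hw : w ∉ gClosure G₂ π.ker := fun hmem =>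
    hg ((gClosure_ker π).le (h π.ker inferInstance hmem))
  obtain ⟨⟨μ, hμ⟩, hμw⟩ : ∃ μ : {μ : FreeGroup ℕ →* G₂ // π.ker ≤ μ.ker}, w ∉ μ.1.ker := by
    simpa only [gClosure, Subgroup.mem_iInf, not_forall] using hw
  let f : G₁ →* G₂ := π.liftOfSurjective hπ ⟨μ, hμ⟩
  refine ⟨f, (MonoidHom.ker_eq_bot_iff f).1 ?_⟩
  refine (IsSimpleGroup.eq_bot_or_eq_top_of_normal f.ker inferInstance).resolve_right
    fun htop => hμw ?_
  have hfw : f (π w) = 1 := MonoidHom.mem_ker.1 (htop ▸ Subgroup.mem_top (π w))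
  rwa [MonoidHom.liftOfRightInverse_comp_apply] at hfw

/-- §3.4: two finite simple groups are geometrically equivalent (with respect to a countably
infinite set of variables) if and only if they are isomorphic. -/
theorem finite_simple_geomEquiv_iff_iso {G₁ G₂ : Type*} [Group G₁] [Group G₂]
    [Finite G₁] [Finite G₂] [IsSimpleGroup G₁] [IsSimpleGroup G₂] :
    (∀ N : Subgroup (FreeGroup ℕ), N.Normal → gClosure G₁ N = gClosure G₂ N) ↔
      Nonempty (G₁ ≃* G₂) := by
  constructor
  · intro h
    obtain ⟨f, hf⟩ := exists_injective_of_gClosure_le fun N hN => (h N hN).ge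
    obtain ⟨g, hg⟩ := exists_injective_of_gClosure_le fun N hN => (h N hN).le
    exact ⟨MulEquiv.ofBijective f
      (hf.bijective_of_nat_card_le (Nat.card_le_card_of_injective g hg))⟩
  · rintro ⟨e⟩ N -
    exact le_antisymm (gClosure_le_of_injective e.symm.toMonoidHom e.symm.injective N)
      (gClosure_le_of_injective e.toMonoidHom e.injective N)
end

section
/- Let A and G be groups and let I be a nonempty type. Then ⋂ over all group homomorphisms ν : A →* G of MonoidHom.ker ν equals ⋂ over all group homomorphisms μ : A →* (I → G) of MonoidHom.ker μ, where I → G carries the pointwise group structure. Consequently, for every type X, the groups G and I → G (the Cartesian power Gᴵ) are geometrically X-equivalent. -/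
theorem mem_gClosure {G W : Type*} [Group G] [Group W] {N : Subgroup W} {w : W} :
    w ∈ gClosure G N ↔ ∀ μ : W →* G, N ≤ μ.ker → μ w = 1 := by
  simp [gClosure, Subgroup.mem_iInf, MonoidHom.mem_ker]

theorem gClosure_bot (G W : Type*) [Group G] [Group W] :
    gClosure G (⊥ : Subgroup W) = ⨅ μ : W →* G, μ.ker := by
  ext w
  simp [mem_gClosure, Subgroup.mem_iInf, MonoidHom.mem_ker]

/-- A group and its nonempty Cartesian powers define the same closure operator. -/
theorem gClosure_pi (G I : Type*) {W : Type*} [Group G] [Group W] [Nonempty I]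
    (N : Subgroup W) : gClosure (I → G) N = gClosure G N := by
  ext w
  simp only [mem_gClosure]
  constructor
  · intro h ν hν
    have hker : N ≤ (MonoidHom.pi fun _ : I => ν).ker := fun n hn =>
      funext fun _ => hν hn
    exact congrFun (h _ hker) (Classical.arbitrary I)
  · intro h μ hμ
    exact funext fun i => h ((Pi.evalMonoidHom (fun _ : I => G) i).comp μ) fun n hn =>
      congrFun (hμ hn) i

/-- §3.4, Proposition 4.4 for groups: for any group `A`, `(G-Ker)(A) = (Gᴵ-Ker)(A)` for a
nonempty index type `I`; consequently `G` and the Cartesian power `I → G` are geometrically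
`X`-equivalent for every set of variables `X`. -/
theorem geomEquiv_pow {A G : Type*} [Group A] [Group G] (I : Type*) [Nonempty I] :
    ((⨅ ν : A →* G, MonoidHom.ker ν) = ⨅ μ : A →* (I → G), MonoidHom.ker μ) ∧
    ∀ (X : Type*) (N : Subgroup (FreeGroup X)), N.Normal →
      gClosure G N = gClosure (I → G) N := by
  refine ⟨?_, fun _ N _ => (gClosure_pi G I N).symm⟩
  rw [← gClosure_bot, ← gClosure_bot, gClosure_pi]
end

section
/- Let X and Y be types with an injection X ↪ Y, and let G₁ and G₂ be groups. If G₁ and G₂ are geometrically Y-equivalent, then G₁ and G₂ are geometrically X-equivalent. -/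
theorem mem_gClosure_iff {G W : Type*} [Group G] [Group W] {N : Subgroup W} {w : W} :
    w ∈ gClosure G N ↔ ∀ μ : W →* G, N ≤ MonoidHom.ker μ → μ w = 1 := by
  simp [gClosure, Subgroup.mem_iInf]

/-- If `r : V →* W` is a retraction with section `i`, closures in `W` are pulled back along `i`
from closures in `V`. -/
theorem gClosure_eq_comap_of_leftInverse (G : Type*) {V W : Type*} [Group G] [Group V] [Group W]
    {r : V →* W} {i : W →* V} (hri : Function.LeftInverse r i) (N : Subgroup W) :
    gClosure G N = (gClosure G (N.comap r)).comap i := by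
  ext w
  rw [Subgroup.mem_comap, mem_gClosure_iff, mem_gClosure_iff]
  constructor
  · intro hw ν hν
    refine hw (ν.comp i) fun n hn => hν ?_
    rwa [Subgroup.mem_comap, hri n]
  · intro hw μ hμ
    have hiw := hw (μ.comp r) fun v hv => hμ hv
    rwa [MonoidHom.comp_apply, hri w] at hiw

theorem FreeGroup.exists_leftInverse_map {X Y : Type*} (e : X ↪ Y) :
    ∃ r : FreeGroup Y →* FreeGroup X, Function.LeftInverse r (FreeGroup.map e) := by
  refine ⟨FreeGroup.lift (Function.extend e FreeGroup.of 1), fun w => ?_⟩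
  have hcomp : (FreeGroup.lift (Function.extend e FreeGroup.of 1)).comp (FreeGroup.map e) =
      MonoidHom.id (FreeGroup X) := by
    ext x
    simp [e.injective.extend_apply]
  exact DFunLike.congr_fun hcomp w

/-- §4.1, Theorem 1.1 for groups: if `X` embeds into `Y` and `G₁`, `G₂` are geometrically
`Y`-equivalent, then they are geometrically `X`-equivalent. -/
theorem geomEquiv_of_embedding {X Y G₁ G₂ : Type*} [Group G₁] [Group G₂] (e : X ↪ Y)
    (h : ∀ N : Subgroup (FreeGroup Y), N.Normal → gClosure G₁ N = gClosure G₂ N) :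
    ∀ N : Subgroup (FreeGroup X), N.Normal → gClosure G₁ N = gClosure G₂ N := by
  intro N hN
  obtain ⟨r, hr⟩ := FreeGroup.exists_leftInverse_map e
  rw [gClosure_eq_comap_of_leftInverse G₁ hr, gClosure_eq_comap_of_leftInverse G₂ hr,
    h _ (hN.comap r)]
end

section
/- Let G₁ and G₂ be commutative groups. Then (G₁-Ker)(A) = (G₂-Ker)(A) holds for every group A if and only if (G₁-Ker)(B) = (G₂-Ker)(B) holds for every commutative group B. -/
/-- The `G`-kernel of a group `A`, for `G` commutative, is pulled back from the abelianization. -/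
theorem iInf_ker_eq_comap_abelianization (A G : Type*) [Group A] [CommGroup G] :
    (⨅ ν : A →* G, MonoidHom.ker ν) =
      (⨅ ν : Abelianization A →* G, MonoidHom.ker ν).comap Abelianization.of := by
  rw [Subgroup.comap_iInf, ← (Abelianization.lift (G := A) (A := G)).symm.iInf_comp]
  simp only [MonoidHom.comap_ker]
  rfl

/-- §4.2, Proposition 2.5 for `Θ` = groups and `Θ₀` = abelian groups, via the kernel
characterization of geometric equivalence (§3.2, Theorem 2.2): two commutative groups
`G₁`, `G₂` satisfy `(G₁-Ker)(A) = (G₂-Ker)(A)` for every group `A` if and only if they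
satisfy it for every commutative group `B`. -/
theorem geomEquiv_groups_iff_commGroups {G₁ G₂ : Type*} [CommGroup G₁] [CommGroup G₂] :
    (∀ (A : Type u) [Group A],
        (⨅ ν : A →* G₁, MonoidHom.ker ν) = ⨅ ν : A →* G₂, MonoidHom.ker ν) ↔
    (∀ (B : Type u) [CommGroup B],
        (⨅ ν : B →* G₁, MonoidHom.ker ν) = ⨅ ν : B →* G₂, MonoidHom.ker ν) := by
  refine ⟨fun h B _ => h B, fun h A _ => ?_⟩
  rw [iInf_ker_eq_comap_abelianization A G₁, iInf_ker_eq_comap_abelianization A G₂,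
    h (Abelianization A)]
end

section
/- Let A₁ and A₂ be commutative groups of finite exponent, i.e. Monoid.exponent A₁ ≠ 0 and Monoid.exponent A₂ ≠ 0. Then (A₁-Ker)(B) = (A₂-Ker)(B) holds for every commutative group B if and only if Monoid.exponent A₁ = Monoid.exponent A₂. -/
/-- Elements killed by `n` in the rational circle are the multiples of `1 / n`. -/
theorem AddCircle.mem_zmultiples_of_nsmul_eq_zero {n : ℕ} (hn : 0 < n) {x : AddCircle (1 : ℚ)}
    (hx : n • x = 0) : x ∈ AddSubgroup.zmultiples ((1 / n : ℚ) : AddCircle (1 : ℚ)) := by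
  obtain ⟨m, -, rfl⟩ := (AddCircle.nsmul_eq_zero_iff hn).mp hx
  refine AddSubgroup.mem_zmultiples_iff.mpr ⟨m, ?_⟩
  rw [← AddCircle.coe_zsmul]
  congr 1
  simp [div_eq_mul_inv]

/-- A commutative group `B` whose exponent divides the nonzero exponent of `A` has enough
homomorphisms to `A` to separate its elements from `1`. -/
theorem exists_monoidHom_apply_ne_one {A B : Type*} [CommGroup A] [CommGroup B]
    (hA : Monoid.exponent A ≠ 0) (hB : Monoid.exponent B ∣ Monoid.exponent A) {b : B}
    (hb : b ≠ 1) : ∃ ν : B →* A, ν b ≠ 1 := by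
  have hn := Nat.pos_of_ne_zero hA
  obtain ⟨g, hg⟩ := Monoid.exists_orderOf_eq_exponent (Monoid.exponent_ne_zero.mp hA)
  obtain ⟨c, hc⟩ := CharacterModule.exists_character_apply_ne_zero_of_ne_zero
    (A := Additive B) (a := Additive.ofMul b) hb
  let u : Multiplicative (AddCircle (1 : ℚ)) :=
    Multiplicative.ofAdd ((1 / Monoid.exponent A : ℚ) : AddCircle (1 : ℚ))
  have hu : orderOf u = orderOf g := by
    rw [hg]
    exact AddCircle.addOrderOf_period_div hn
  let φ : B →* Multiplicative (AddCircle (1 : ℚ)) := AddMonoidHom.toMultiplicativeRight c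
  have hφ (x : B) : φ x ∈ Subgroup.zpowers u := by
    refine AddCircle.mem_zmultiples_of_nsmul_eq_zero hn (x := (φ x).toAdd) ?_
    have : φ x ^ Monoid.exponent A = 1 := by
      rw [← map_pow, Monoid.exponent_dvd_iff_forall_pow_eq_one.mp hB x, map_one]
    exact this
  let e : Subgroup.zpowers u ≃* Subgroup.zpowers g :=
    mulEquivOfOrderOfEq (g := ⟨u, Subgroup.mem_zpowers u⟩) (g' := ⟨g, Subgroup.mem_zpowers g⟩)
      (by rintro ⟨_, k, rfl⟩; exact ⟨k, rfl⟩) (by rintro ⟨_, k, rfl⟩; exact ⟨k, rfl⟩)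
      (by simpa using hu)
  refine ⟨(Subgroup.zpowers g).subtype.comp (e.toMonoidHom.comp (φ.codRestrict _ hφ)),
    fun h ↦ hc ?_⟩
  have h' : e (φ.codRestrict _ hφ b) = 1 := Subtype.ext h
  exact congrArg Subtype.val ((map_eq_one_iff e e.injective).mp h')

/-- The intersection of the kernels of all homomorphisms into a commutative group of nonzero
exponent `n` is the subgroup of `n`-th powers. -/
theorem iInf_ker_eq_range_powMonoidHom {A B : Type*} [CommGroup A] [CommGroup B]
    (hA : Monoid.exponent A ≠ 0) :
    (⨅ ν : B →* A, ν.ker) = (powMonoidHom (Monoid.exponent A) : B →* B).range := by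
  refine le_antisymm (fun b hb ↦ ?_) (le_iInf fun ν ↦ ?_)
  · by_contra hb'
    let P := (powMonoidHom (Monoid.exponent A) : B →* B).range
    have hP : Monoid.exponent (B ⧸ P) ∣ Monoid.exponent A := by
      refine Monoid.exponent_dvd_iff_forall_pow_eq_one.mpr fun x ↦ ?_
      induction x using QuotientGroup.induction_on with
      | H x => exact (QuotientGroup.eq_one_iff _).mpr ⟨x, rfl⟩
    obtain ⟨ν, hν⟩ :=
      exists_monoidHom_apply_ne_one hA hP (mt (QuotientGroup.eq_one_iff b).mp hb')
    exact hν (Subgroup.mem_iInf.mp hb (ν.comp (QuotientGroup.mk' P)))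
  · rintro _ ⟨b, rfl⟩
    simp [MonoidHom.mem_ker, Monoid.pow_exponent_eq_one]

/-- If the subgroups of `m`-th and `n`-th powers coincide in every commutative group, then
`n ∣ m`. -/
theorem dvd_of_forall_range_powMonoidHom_eq {m n : ℕ}
    (h : ∀ (B : Type u) [CommGroup B],
      (powMonoidHom m : B →* B).range = (powMonoidHom n : B →* B).range) : n ∣ m := by
  let B := ULift.{u} (Multiplicative (ZMod n))
  have hB : (ULift.up (Multiplicative.ofAdd 1) : B) ^ m ∈ (powMonoidHom n : B →* B).range :=
    h B ▸ ⟨_, rfl⟩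
  obtain ⟨⟨x⟩, hx⟩ := hB
  have hx' : (n : ℕ) • x.toAdd = m • (1 : ZMod n) := congrArg (fun y : B ↦ y.down.toAdd) hx
  exact (ZMod.natCast_eq_zero_iff m n).mp (by simpa using hx'.symm)

/-- §5.5, Theorem 5.7: two commutative groups of finite exponent are geometrically
equivalent (in the variety of abelian groups, via the kernel characterization of §3.2,
Theorem 2.2) if and only if their exponents coincide. -/
theorem geomEquiv_iff_exponent_eq {A₁ A₂ : Type*} [CommGroup A₁] [CommGroup A₂]
    (h₁ : Monoid.exponent A₁ ≠ 0) (h₂ : Monoid.exponent A₂ ≠ 0) :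
    (∀ (B : Type u) [CommGroup B],
        (⨅ ν : B →* A₁, MonoidHom.ker ν) = ⨅ ν : B →* A₂, MonoidHom.ker ν) ↔
      Monoid.exponent A₁ = Monoid.exponent A₂ := by
  simp only [iInf_ker_eq_range_powMonoidHom h₁, iInf_ker_eq_range_powMonoidHom h₂]
  refine ⟨fun h ↦ Nat.dvd_antisymm ?_ (dvd_of_forall_range_powMonoidHom_eq h),
    fun h B _ ↦ by rw [h]⟩
  exact dvd_of_forall_range_powMonoidHom_eq fun B _ ↦ (h B).symm
end

section
/- Let G be a group, I a type, and (H i) for i : I a family of groups. Then the intersection ⋂ over all group homomorphisms μ : G →* (∀ i, H i) of MonoidHom.ker μ equals the intersection ⋂ over i : I of the intersections ⋂ over all group homomorphisms ν : G →* H i of MonoidHom.ker ν; that is, ((∀ i, H i)-Ker)(G) = ⋂ᵢ ((H i)-Ker)(G), where ∀ i, H i carries the pointwise group structure. -/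
/-- §5.5, Proposition 5.3 for groups: `((∏ᵢ Hᵢ)-Ker)(G) = ⋂ᵢ (Hᵢ-Ker)(G)`, i.e. the
intersection of the kernels of all homomorphisms from `G` to a Cartesian product equals the
intersection over `i` of the intersections of the kernels of all homomorphisms `G →* H i`. -/
theorem interKer_pi {G : Type*} [Group G] {I : Type*} (H : I → Type*) [∀ i, Group (H i)] :
    (⨅ μ : G →* (∀ i, H i), MonoidHom.ker μ) =
      ⨅ i, ⨅ ν : G →* H i, MonoidHom.ker ν := by
  classical
  apply le_antisymm
  · refine le_iInf₂ fun i ν => (iInf_le _ ((MonoidHom.mulSingle H i).comp ν)).trans fun x hx => ?_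
    simpa [MonoidHom.mem_ker] using hx
  · refine le_iInf fun μ x hx => ?_
    simp only [Subgroup.mem_iInf, MonoidHom.mem_ker] at hx ⊢
    exact funext fun i => hx i ((Pi.evalMonoidHom H i).comp μ)
end

section
/- Let G be an additive commutative group, I a type with decidable equality, and (H i) for i : I a family of additive commutative groups. Then the intersection ⋂ over all additive group homomorphisms μ : G →+ (⨁ i, H i) of AddMonoidHom.ker μ equals the intersection ⋂ over all additive group homomorphisms μ : G →+ (∀ i, H i) of AddMonoidHom.ker μ, where ⨁ i, H i is the direct sum (finitely supported elements of the product) and ∀ i, H i is the Cartesian product with pointwise addition. -/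
open DirectSum

/-- §5.5, Proposition 5.4 for abelian groups: the direct sum and the Cartesian product of a
family of abelian groups have the same kernel on every abelian group `G`:
`(⨁ᵢ Hᵢ-Ker)(G) = (∏ᵢ Hᵢ-Ker)(G)`. -/
theorem interKer_directSum_eq_interKer_pi {G : Type*} [AddCommGroup G]
    {I : Type*} [DecidableEq I] (H : I → Type*) [∀ i, AddCommGroup (H i)] :
    (⨅ μ : G →+ (⨁ i, H i), AddMonoidHom.ker μ) =
      ⨅ μ : G →+ (∀ i, H i), AddMonoidHom.ker μ := by
  ext g
  simp only [AddSubgroup.mem_iInf, AddMonoidHom.mem_ker]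
  constructor
  · intro h μ
    funext i
    simpa using congrArg (fun x : ⨁ i, H i => x i)
      (h ((DirectSum.of H i).comp ((Pi.evalAddMonoidHom H i).comp μ)))
  · intro h μ
    exact DFunLike.coe_injective (h ((DirectSum.coeFnAddMonoidHom H).comp μ))
end

section
/- Let I be a type and let (H i) and (H' i) for i : I be families of groups such that for every i : I and every group A, ((H i)-Ker)(A) = ((H' i)-Ker)(A) (i.e. H i and H' i are geometrically equivalent). Then for every group A, the intersection ⋂ over all group homomorphisms μ : A →* (∀ i, H i) of MonoidHom.ker μ equals the intersection ⋂ over all group homomorphisms μ : A →* (∀ i, H' i) of MonoidHom.ker μ; that is, the Cartesian products ∀ i, H i and ∀ i, H' i are geometrically equivalent. -/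
/-- The common kernel of all homomorphisms into a product is the intersection of the common
kernels of all homomorphisms into the factors. -/
theorem MonoidHom.iInf_ker_pi {I A : Type*} (H : I → Type*) [Group A] [∀ i, Group (H i)] :
    (⨅ μ : A →* (∀ i, H i), MonoidHom.ker μ) = ⨅ i, ⨅ ν : A →* H i, MonoidHom.ker ν := by
  classical
  ext a
  simp only [Subgroup.mem_iInf, MonoidHom.mem_ker]
  constructor
  · intro ha i ν
    simpa using congrFun (ha ((MonoidHom.mulSingle H i).comp ν)) i
  · intro ha μ
    ext i
    exact ha i ((Pi.evalMonoidHom H i).comp μ)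

/-- §5.5, Proposition 5.5 for groups: Cartesian products of geometrically equivalent
families of groups are geometrically equivalent, geometric equivalence being expressed via
the kernel characterization of §3.2, Theorem 2.2: `(H-Ker)(A) = ⨅ ν : A →* H, ker ν`. -/
theorem geomEquiv_pi_of_geomEquiv {I : Type*} (H H' : I → Type v)
    [∀ i, Group (H i)] [∀ i, Group (H' i)]
    (h : ∀ i, ∀ (A : Type u) [Group A],
      (⨅ ν : A →* H i, MonoidHom.ker ν) = ⨅ ν : A →* H' i, MonoidHom.ker ν) :
    ∀ (A : Type u) [Group A],
      (⨅ μ : A →* (∀ i, H i), MonoidHom.ker μ) =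
        ⨅ μ : A →* (∀ i, H' i), MonoidHom.ker μ := by
  intro A _
  simp only [MonoidHom.iInf_ker_pi, h]
end
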